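/- Let D ⊂ ℝ³ be a nonempty bounded open set with closure K, let Γ be a nonempty compact subset of ℝ³ with d₀ := inf{|x−y| : x ∈ K, y ∈ Γ} > 0, let μ be a finite Borel measure on ℝ³ with μ(ℝ³ ∖ Γ) = 0, let C' ≥ 1, and for each τ ≥ 1 let ψ_τ : ℝ³ → ℝ be measurable with C'⁻¹ ≤ ψ_τ(y) ≤ C' for all y ∈ Γ. Define G_τ(x) = (1/(2π)) ∫_Γ ψ_τ(y) (e^{−√τ |x−y|}/|x−y|) (√τ + 1/|x−y|) ((x−y)/|x−y|) dμ(y). Assume: (i) whenever x ∈ K and y, y' ∈ Γ satisfy |x−y| = |x−y'| = d₀, then y = y'; (ii) there exists (x₀,y₀) ∈ K × Γ with |x₀−y₀| = d₀ such that for every δ > 0 one has liminf_{τ→∞} τ^{3/2} ∫_{D ∩ B_δ(x₀)} e^{−2√τ |x−x₀|} dx > 0 and liminf_{τ→∞} τ ∫_{Γ ∩ B_δ(y₀)} e^{−√τ |y−y₀|} dμ(y) > 0. Then liminf_{τ→∞} τ^{5/2} e^{2√τ d₀} ∫_D |G_τ(x)|² dx > 0. -/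

import Mathlib

open MeasureTheory Filter Metric
open scoped Topology

section LayerKernel

variable {E : Type*} [NormedAddCommGroup E] [InnerProductSpace ℝ E]

/-- Up to the factor `1 / (2π)`, the negative gradient in `x` of the density `ψ y` times the
Yukawa kernel `exp (-s ‖x - y‖) / ‖x - y‖`. -/
noncomputable def layerKernel (s : ℝ) (ψ : E → ℝ) (x y : E) : E :=
  (ψ y * (Real.exp (-s * ‖x - y‖) / ‖x - y‖) * (s + 1 / ‖x - y‖) * ‖x - y‖⁻¹) • (x - y)

lemma norm_layerKernel_le {s d C : ℝ} {ψ : E → ℝ} {x y : E} (hs : 1 ≤ s) (hd : 0 < d)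
    (hxy : d ≤ ‖x - y‖) (hψ : |ψ y| ≤ C) :
    ‖layerKernel s ψ x y‖ ≤ C * ((1 + 1 / d) / d) * s * Real.exp (-s * ‖x - y‖) := by
  unfold layerKernel
  generalize hv : x - y = v at *
  have hr : 0 < ‖v‖ := hd.trans_le hxy
  have hC : 0 ≤ C := (abs_nonneg _).trans hψ
  rw [norm_smul, Real.norm_eq_abs, abs_mul, abs_mul, abs_mul,
    abs_of_pos (by positivity : 0 < Real.exp (-s * ‖v‖) / ‖v‖),
    abs_of_pos (by positivity : 0 < s + 1 / ‖v‖), abs_of_pos (by positivity : 0 < ‖v‖⁻¹)]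
  have h1 : s + 1 / ‖v‖ ≤ (1 + 1 / d) * s := by
    have h2 : 1 / ‖v‖ ≤ 1 / d := one_div_le_one_div_of_le hd hxy
    have h3 : 0 < 1 / d := by positivity
    nlinarith
  calc |ψ y| * (Real.exp (-s * ‖v‖) / ‖v‖) * (s + 1 / ‖v‖) * ‖v‖⁻¹ * ‖v‖
      = |ψ y| * (Real.exp (-s * ‖v‖) / ‖v‖) * (s + 1 / ‖v‖) := by field_simp
    _ ≤ C * (Real.exp (-s * ‖v‖) / d) * ((1 + 1 / d) * s) := by gcongr
    _ = _ := by ring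

lemma le_inner_layerKernel {s d C : ℝ} {ψ : E → ℝ} {x y e : E} (hs : 0 < s) (hd : 0 < d)
    (hC : 0 < C) (he : d / 2 ≤ inner ℝ e (x - y)) (hxy : x ≠ y) (hxy' : ‖x - y‖ ≤ 2 * d)
    (hψ : C⁻¹ ≤ ψ y) :
    C⁻¹ / (8 * d) * s * Real.exp (-s * ‖x - y‖) ≤ inner ℝ e (layerKernel s ψ x y) := by
  have hr : 0 < ‖x - y‖ := norm_pos_iff.2 (sub_ne_zero.2 hxy)
  unfold layerKernel
  generalize x - y = v at *
  rw [inner_smul_right]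
  have hψ0 : 0 < ψ y := (inv_pos.2 hC).trans_le hψ
  have h1 : s ≤ s + 1 / ‖v‖ := le_add_of_nonneg_right (by positivity)
  calc C⁻¹ / (8 * d) * s * Real.exp (-s * ‖v‖)
      = C⁻¹ * (Real.exp (-s * ‖v‖) / (2 * d)) * s * (2 * d)⁻¹ * (d / 2) := by
        field_simp; norm_num
    _ ≤ ψ y * (Real.exp (-s * ‖v‖) / ‖v‖) * (s + 1 / ‖v‖) * ‖v‖⁻¹ * inner ℝ e v := by
        gcongr

variable [MeasurableSpace E]

lemma norm_setIntegral_layerKernel_le {s d C : ℝ} {ψ : E → ℝ} {x : E} {Γ : Set E}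
    {μ : Measure E} [IsFiniteMeasure μ] (hs : 1 ≤ s) (hd : 0 < d) (hC : 0 ≤ C)
    (hxΓ : ∀ y ∈ Γ, d ≤ ‖x - y‖) (hψ : ∀ y ∈ Γ, |ψ y| ≤ C) :
    ‖∫ y in Γ, layerKernel s ψ x y ∂μ‖ ≤
      C * ((1 + 1 / d) / d) * s * Real.exp (-s * d) * μ.real Γ := by
  refine norm_setIntegral_le_of_norm_le_const (measure_lt_top μ Γ) fun y hy => ?_
  refine (norm_layerKernel_le hs hd (hxΓ y hy) (hψ y hy)).trans ?_
  have := hxΓ y hy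
  have : -s * ‖x - y‖ ≤ -s * d := by nlinarith
  gcongr

variable [BorelSpace E] [SecondCountableTopology E]

lemma measurable_layerKernel (s : ℝ) {ψ : E → ℝ} (hψ : Measurable ψ) :
    Measurable (fun p : E × E => layerKernel s ψ p.1 p.2) := by
  unfold layerKernel
  fun_prop

lemma integrableOn_layerKernel {s d C : ℝ} {ψ : E → ℝ} {x : E} {Γ : Set E} {μ : Measure E}
    [IsFiniteMeasure μ] (hΓ : MeasurableSet Γ) (hs : 1 ≤ s) (hd : 0 < d)
    (hxΓ : ∀ y ∈ Γ, d ≤ ‖x - y‖) (hψm : Measurable ψ) (hψ : ∀ y ∈ Γ, |ψ y| ≤ C) :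
    IntegrableOn (layerKernel s ψ x) Γ μ := by
  refine Measure.integrableOn_of_bounded (M := C * ((1 + 1 / d) / d) * s)
    (measure_ne_top μ Γ)
    ((measurable_layerKernel s hψm).comp measurable_prodMk_left).aestronglyMeasurable ?_
  refine (ae_restrict_iff' hΓ).2 (ae_of_all _ fun y hy => ?_)
  refine (norm_layerKernel_le hs hd (hxΓ y hy) (hψ y hy)).trans ?_
  have hC : 0 ≤ C := (abs_nonneg _).trans (hψ y hy)
  refine mul_le_of_le_one_right (by positivity) (Real.exp_le_one_iff.2 ?_)
  nlinarith [norm_nonneg (x - y)]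

/-- The near part of `Γ` dominates: a lower bound for the layer integral close to `x₀`. -/
lemma le_norm_setIntegral_layerKernel [CompleteSpace E] {s d ε C : ℝ} {ψ : E → ℝ} {x x₀ y₀ : E}
    {Γ : Set E} {μ : Measure E} [IsFiniteMeasure μ] (hΓ : MeasurableSet Γ) (hs : 1 ≤ s)
    (hd : 0 < d) (hC : 1 ≤ C) (hxΓ : ∀ y ∈ Γ, d ≤ ‖x - y‖)
    (hxy₀ : dist x₀ y₀ = d) (hfar : ∀ y ∈ Γ \ ball y₀ (d / 4), d + 2 * ε ≤ dist x₀ y)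
    (hxd : dist x x₀ ≤ d / 4) (hxε : dist x x₀ ≤ ε / 2)
    (hψm : Measurable ψ) (hψ : ∀ y ∈ Γ, C⁻¹ ≤ ψ y ∧ ψ y ≤ C) :
    s * Real.exp (-s * (d + dist x x₀)) *
      (C⁻¹ / (8 * d) * (∫ y in Γ ∩ ball y₀ (d / 4), Real.exp (-s * dist y y₀) ∂μ) -
        C * ((1 + 1 / d) / d) * Real.exp (-s * ε) * μ.real Γ) ≤
      ‖∫ y in Γ, layerKernel s ψ x y ∂μ‖ := by
  have hC0 : 0 < C := by linarith
  have hψ' : ∀ y ∈ Γ, |ψ y| ≤ C := fun y hy =>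
    abs_le.2 ⟨by linarith [(hψ y hy).1, inv_pos.2 hC0], (hψ y hy).2⟩
  have hint := integrableOn_layerKernel (μ := μ) hΓ hs hd hxΓ hψm hψ'
  set N := Γ ∩ ball y₀ (d / 4)
  set F := Γ \ ball y₀ (d / 4)
  have hsplit : ∫ y in Γ, layerKernel s ψ x y ∂μ =
      (∫ y in N, layerKernel s ψ x y ∂μ) + ∫ y in F, layerKernel s ψ x y ∂μ :=
    (integral_inter_add_sdiff measurableSet_ball hint).symm
  set e : E := d⁻¹ • (x₀ - y₀) with he
  have hnorm : ‖x₀ - y₀‖ = d := by rw [← dist_eq_norm, hxy₀]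
  have he1 : ‖e‖ = 1 := by
    rw [he, norm_smul, hnorm, Real.norm_of_nonneg (by positivity)]
    field_simp
  have hinner : ∀ y ∈ N, d / 2 ≤ inner ℝ e (x - y) := by
    intro y hy
    have hy' : dist y y₀ < d / 4 := hy.2
    have h1 : x - y = (x₀ - y₀) + ((x - x₀) - (y - y₀)) := by abel
    have h2 : inner ℝ e (x₀ - y₀) = d := by
      rw [he, real_inner_smul_left, real_inner_self_eq_norm_sq, hnorm]
      field_simp
    have h3 : |inner ℝ e ((x - x₀) - (y - y₀))| ≤ d / 2 := by
      refine (abs_real_inner_le_norm _ _).trans ?_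
      rw [he1, one_mul]
      refine (norm_sub_le _ _).trans ?_
      rw [← dist_eq_norm, ← dist_eq_norm]
      linarith
    rw [h1, inner_add_right, h2]
    linarith [(abs_le.1 h3).1]
  have hnear : C⁻¹ / (8 * d) * s * Real.exp (-s * (d + dist x x₀)) *
      (∫ y in N, Real.exp (-s * dist y y₀) ∂μ) ≤
      inner ℝ e (∫ y in N, layerKernel s ψ x y ∂μ) := by
    have hintN : IntegrableOn (layerKernel s ψ x) N μ := hint.mono_set Set.inter_subset_left
    rw [← integral_inner hintN, ← integral_const_mul]
    refine integral_mono_of_nonneg (ae_of_all _ fun y => by positivity)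
      (hintN.const_inner e) ((ae_restrict_iff' (hΓ.inter measurableSet_ball)).2
        (ae_of_all _ fun y hy => ?_))
    have hy' : dist y y₀ < d / 4 := hy.2
    have htri : ‖x - y‖ ≤ d + dist x x₀ + dist y y₀ := by
      rw [← dist_eq_norm, ← hxy₀, dist_comm y y₀]
      linarith [dist_triangle4 x x₀ y₀ y]
    have hpos : 0 < ‖x - y‖ := hd.trans_le (hxΓ y hy.1)
    refine le_trans ?_ (le_inner_layerKernel (C := C) (by linarith) hd hC0 (hinner y hy)
      (sub_ne_zero.1 (norm_pos_iff.1 hpos)) (by linarith) (hψ y hy.1).1)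
    beta_reduce
    rw [mul_assoc, ← Real.exp_add]
    have : -s * (d + dist x x₀) + -s * dist y y₀ ≤ -s * ‖x - y‖ := by nlinarith
    gcongr
  have hfar' : ‖∫ y in F, layerKernel s ψ x y ∂μ‖ ≤
      C * ((1 + 1 / d) / d) * s * Real.exp (-s * (d + dist x x₀)) * Real.exp (-s * ε) *
        μ.real Γ := by
    have hintF : ∀ y ∈ F, d + dist x x₀ + ε ≤ ‖x - y‖ := fun y hy => by
      rw [← dist_eq_norm]
      linarith [hfar y hy, dist_triangle_left x₀ y x]
    refine (norm_setIntegral_le_of_norm_le_const (measure_lt_top μ F)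
      (C := C * ((1 + 1 / d) / d) * s * Real.exp (-s * (d + dist x x₀)) * Real.exp (-s * ε))
      fun y hy => ?_).trans ?_
    · refine (norm_layerKernel_le hs hd (hxΓ y hy.1) (hψ' y hy.1)).trans ?_
      rw [mul_assoc _ (Real.exp (-s * (d + _))), ← Real.exp_add]
      have : -s * ‖x - y‖ ≤ -s * (d + dist x x₀) + -s * ε := by nlinarith [hintF y hy]
      gcongr
    · exact mul_le_mul_of_nonneg_left (measureReal_mono Set.sdiff_subset) (by positivity)
  have hle : inner ℝ e (∫ y in Γ, layerKernel s ψ x y ∂μ) ≤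
      ‖∫ y in Γ, layerKernel s ψ x y ∂μ‖ := by
    simpa [he1] using real_inner_le_norm e (∫ y in Γ, layerKernel s ψ x y ∂μ)
  have hF' : -‖∫ y in F, layerKernel s ψ x y ∂μ‖ ≤
      inner ℝ e (∫ y in F, layerKernel s ψ x y ∂μ) := by
    have := abs_real_inner_le_norm e (∫ y in F, layerKernel s ψ x y ∂μ)
    rw [he1, one_mul] at this
    exact (abs_le.1 this).1
  refine le_trans ?_ hle
  rw [hsplit, inner_add_right]
  linarith

end LayerKernel

/-- Exponential decay in `√τ` beats the power `τ⁻¹`. -/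
lemma eventually_mul_exp_neg_sqrt_le {A B ε : ℝ} (hB : 0 < B) (hε : 0 < ε) :
    ∀ᶠ τ : ℝ in atTop, A * Real.exp (-Real.sqrt τ * ε) ≤ B / τ := by
  have h : Tendsto (fun τ : ℝ => A * (Real.sqrt τ ^ 2 * Real.exp (-ε * Real.sqrt τ)))
      atTop (𝓝 (A * 0)) := by
    refine Tendsto.const_mul A ?_
    have h := (tendsto_rpow_mul_exp_neg_mul_atTop_nhds_zero 2 ε hε).comp Real.tendsto_sqrt_atTop
    refine h.congr fun τ => ?_
    simp
  rw [mul_zero] at h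
  filter_upwards [h.eventually (ge_mem_nhds hB), eventually_gt_atTop 0] with τ h1 hτ
  rw [le_div_iff₀ hτ]
  rw [Real.sq_sqrt hτ.le] at h1
  rw [show -Real.sqrt τ * ε = -ε * Real.sqrt τ by ring]
  linarith

/-- Lower bound (2.15) of Lemma 2.1 (with `λ₂ = 5/2`) in single-layer-potential
form: `liminf_{τ→∞} τ^{5/2} e^{2√τ d₀} ∫_D |G_τ|² dx > 0`, under the uniqueness
of nearest points (Claim 2) and the local lower bounds (Claims 3 and 4). -/
theorem lemma21_lower
    (D : Set (EuclideanSpace ℝ (Fin 3))) (hDo : IsOpen D) (hDne : D.Nonempty)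
    (hDb : Bornology.IsBounded D)
    (K : Set (EuclideanSpace ℝ (Fin 3))) (hK : K = closure D)
    (Γ : Set (EuclideanSpace ℝ (Fin 3))) (hΓc : IsCompact Γ) (hΓne : Γ.Nonempty)
    (d₀ : ℝ)
    (hd₀ : d₀ = sInf {r : ℝ | ∃ x ∈ K, ∃ y ∈ Γ, r = dist x y})
    (hd₀pos : 0 < d₀)
    (μ : Measure (EuclideanSpace ℝ (Fin 3))) [IsFiniteMeasure μ]
    (hμ : μ Γᶜ = 0)
    (C' : ℝ) (hC' : 1 ≤ C')
    (ψ : ℝ → EuclideanSpace ℝ (Fin 3) → ℝ)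
    (hψm : ∀ τ, Measurable (ψ τ))
    (hψb : ∀ τ ≥ (1 : ℝ), ∀ y ∈ Γ, C'⁻¹ ≤ ψ τ y ∧ ψ τ y ≤ C')
    (G : ℝ → EuclideanSpace ℝ (Fin 3) → EuclideanSpace ℝ (Fin 3))
    (hG : ∀ τ x, G τ x = (1 / (2 * Real.pi)) •
      ∫ y in Γ, (ψ τ y * (Real.exp (-Real.sqrt τ * ‖x - y‖) / ‖x - y‖) *
        (Real.sqrt τ + 1 / ‖x - y‖) * ‖x - y‖⁻¹) • (x - y) ∂μ)
    (huniq : ∀ x ∈ K, ∀ y ∈ Γ, ∀ y' ∈ Γ,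
      dist x y = d₀ → dist x y' = d₀ → y = y')
    (hclosest : ∃ x₀ ∈ K, ∃ y₀ ∈ Γ, dist x₀ y₀ = d₀ ∧
      ∀ δ > (0 : ℝ),
        (∃ c > 0, ∀ᶠ τ : ℝ in atTop,
          c ≤ τ ^ ((3 : ℝ) / 2) *
            ∫ x in D ∩ ball x₀ δ, Real.exp (-2 * Real.sqrt τ * dist x x₀)) ∧
        (∃ c > 0, ∀ᶠ τ : ℝ in atTop,
          c ≤ τ * ∫ y in Γ ∩ ball y₀ δ, Real.exp (-Real.sqrt τ * dist y y₀) ∂μ)) :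
    ∃ c > 0, ∀ᶠ τ : ℝ in atTop,
      c ≤ τ ^ ((5 : ℝ) / 2) * Real.exp (2 * Real.sqrt τ * d₀) *
        ∫ x in D, ‖G τ x‖ ^ 2 := by
  have hC0 : 0 < C' := by linarith
  have hΓm : MeasurableSet Γ := hΓc.measurableSet
  have hDm : MeasurableSet D := hDo.measurableSet
  have hdist : ∀ x ∈ K, ∀ y ∈ Γ, d₀ ≤ ‖x - y‖ := fun x hx y hy => by
    rw [hd₀, ← dist_eq_norm]
    refine csInf_le ⟨0, ?_⟩ ⟨x, hx, y, hy, rfl⟩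
    rintro r ⟨x, -, y, -, rfl⟩
    exact dist_nonneg
  have hDK : D ⊆ K := hK ▸ subset_closure
  obtain ⟨x₀, hx₀, y₀, hy₀, hxy₀, hloc⟩ := hclosest
  obtain ⟨ε, hε, hfar⟩ : ∃ ε > 0, ∀ y ∈ Γ \ ball y₀ (d₀ / 4), d₀ + 2 * ε ≤ dist x₀ y := by
    obtain ⟨a, ha, hle⟩ := (hΓc.diff (isOpen_ball (x := y₀) (ε := d₀ / 4))).exists_forall_le'
      (f := fun y => dist x₀ y) (a := d₀) (by fun_prop) (fun y hy => by
        refine lt_of_le_of_ne (by simpa [dist_eq_norm] using hdist x₀ hx₀ y hy.1) fun h => ?_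
        have := huniq x₀ hx₀ y hy.1 y₀ hy₀ h.symm hxy₀
        exact hy.2 (this ▸ mem_ball_self (by positivity)))
    exact ⟨(a - d₀) / 2, by linarith, fun y hy => by linarith [hle y hy]⟩
  set δ := min (d₀ / 4) (ε / 2)
  obtain ⟨c₁, hc₁, hvol⟩ := (hloc δ (by positivity)).1
  obtain ⟨c₂, hc₂, hsurf⟩ := (hloc (d₀ / 4) (by positivity)).2
  set b := C'⁻¹ / (8 * d₀) with hb
  have hbpos : 0 < b := by positivity
  set k := 1 / (2 * Real.pi) * (b * c₂ / 2) with hk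
  have hkpos : 0 < k := by positivity
  refine ⟨k ^ 2 * c₁, by positivity, ?_⟩
  filter_upwards [hvol, hsurf, eventually_ge_atTop 1,
    eventually_mul_exp_neg_sqrt_le (A := C' * ((1 + 1 / d₀) / d₀) * μ.real Γ)
      (B := b * c₂ / 2) (by positivity) hε] with τ hvolτ hsurfτ hτ hexp
  have hτ0 : 0 < τ := by linarith
  set s := Real.sqrt τ with hs
  have hs1 : 1 ≤ s := Real.one_le_sqrt.2 hτ
  have hs0 : 0 < s := by linarith
  have hsτ : s ^ 2 = τ := Real.sq_sqrt hτ0.le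
  have hGk : ∀ x, G τ x = (1 / (2 * Real.pi)) • ∫ y in Γ, layerKernel s (ψ τ) x y ∂μ := hG τ
  have hψ' : ∀ y ∈ Γ, |ψ τ y| ≤ C' := fun y hy =>
    abs_le.2 ⟨by linarith [(hψb τ hτ y hy).1, inv_pos.2 hC0], (hψb τ hτ y hy).2⟩
  have hlower : ∀ x ∈ D ∩ ball x₀ δ,
      k ^ 2 * (τ⁻¹ * Real.exp (-2 * s * d₀)) * Real.exp (-2 * s * dist x x₀) ≤
        ‖G τ x‖ ^ 2 := by
    intro x hx
    have hxδ : dist x x₀ < δ := hx.2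
    have h := le_norm_setIntegral_layerKernel (μ := μ) (ψ := ψ τ) hΓm hs1 hd₀pos hC'
      (hdist x (hDK hx.1)) hxy₀ hfar (hxδ.le.trans (min_le_left _ _))
      (hxδ.le.trans (min_le_right _ _)) (hψm τ) (hψb τ hτ)
    have hsurf' : c₂ / τ ≤ ∫ y in Γ ∩ ball y₀ (d₀ / 4), Real.exp (-s * dist y y₀) ∂μ := by
      rw [div_le_iff₀ hτ0]
      linarith
    have hdiff : b * c₂ / 2 / τ ≤
        b * (∫ y in Γ ∩ ball y₀ (d₀ / 4), Real.exp (-s * dist y y₀) ∂μ) -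
        C' * ((1 + 1 / d₀) / d₀) * Real.exp (-s * ε) * μ.real Γ := by
      have h1 := mul_le_mul_of_nonneg_left hsurf' hbpos.le
      have h2 : b * (c₂ / τ) = b * c₂ / 2 / τ + b * c₂ / 2 / τ := by ring
      linarith
    have hbound : k * (s⁻¹ * Real.exp (-s * (d₀ + dist x x₀))) ≤ ‖G τ x‖ := by
      rw [hGk, norm_smul, Real.norm_of_nonneg (by positivity), hk, mul_assoc]
      gcongr
      refine le_trans (le_of_eq ?_) ((mul_le_mul_of_nonneg_left hdiff (by positivity)).trans h)
      rw [← hsτ]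
      field_simp
    refine le_trans (le_of_eq ?_) (pow_le_pow_left₀ (by positivity) hbound 2)
    rw [mul_pow k, mul_pow s⁻¹, ← Real.exp_nat_mul, inv_pow, hsτ, mul_assoc, mul_assoc,
      ← Real.exp_add]
    congr 3
    push_cast
    ring
  have hGint : IntegrableOn (fun x => ‖G τ x‖ ^ 2) D := by
    have hGm : StronglyMeasurable (G τ) := by
      have h : StronglyMeasurable (fun x => ∫ y in Γ, layerKernel s (ψ τ) x y ∂μ) :=
        (measurable_layerKernel s (hψm τ)).stronglyMeasurable.integral_prod_right
      rw [funext hGk]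
      exact h.const_smul (1 / (2 * Real.pi))
    refine Measure.integrableOn_of_bounded (M := (1 / (2 * Real.pi) * (C' *
      ((1 + 1 / d₀) / d₀) * s * Real.exp (-s * d₀) * μ.real Γ)) ^ 2) hDb.measure_lt_top.ne
      (hGm.norm.pow 2).aestronglyMeasurable
      ((ae_restrict_iff' hDm).2 (ae_of_all _ fun x hx => ?_))
    rw [Real.norm_of_nonneg (by positivity), hGk, norm_smul,
      Real.norm_of_nonneg (by positivity : 0 ≤ 1 / (2 * Real.pi))]
    gcongr
    exact norm_setIntegral_layerKernel_le hs1 hd₀pos hC0.le (hdist x (hDK hx)) hψ'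
  have hI : k ^ 2 * (τ⁻¹ * Real.exp (-2 * s * d₀)) *
      (∫ x in D ∩ ball x₀ δ, Real.exp (-2 * s * dist x x₀)) ≤ ∫ x in D, ‖G τ x‖ ^ 2 := by
    rw [← integral_const_mul]
    refine le_trans ?_ (setIntegral_mono_set hGint (ae_of_all _ fun x => by positivity)
      (Set.inter_subset_left (t := ball x₀ δ)).eventuallyLE)
    exact integral_mono_of_nonneg (ae_of_all _ fun x => by positivity)
      (hGint.mono_set Set.inter_subset_left)
      ((ae_restrict_iff' (hDm.inter measurableSet_ball)).2 (ae_of_all _ hlower))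
  have hpow : τ ^ ((5 : ℝ) / 2) = τ ^ ((3 : ℝ) / 2) * τ := by
    rw [← Real.rpow_add_one hτ0.ne']
    norm_num
  have hexp1 : Real.exp (2 * s * d₀) * Real.exp (-2 * s * d₀) = 1 := by
    rw [← Real.exp_add, ← Real.exp_zero]
    congr 1
    ring
  calc k ^ 2 * c₁
      ≤ k ^ 2 * (τ ^ ((3 : ℝ) / 2) *
          ∫ x in D ∩ ball x₀ δ, Real.exp (-2 * s * dist x x₀)) := by gcongr
    _ = τ ^ ((5 : ℝ) / 2) * Real.exp (2 * s * d₀) * (k ^ 2 * (τ⁻¹ * Real.exp (-2 * s * d₀)) *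
          ∫ x in D ∩ ball x₀ δ, Real.exp (-2 * s * dist x x₀)) := by
        rw [hpow]
        linear_combination (-(k ^ 2 * τ ^ ((3 : ℝ) / 2) *
          (∫ x in D ∩ ball x₀ δ, Real.exp (-2 * s * dist x x₀)) * (τ * τ⁻¹))) * hexp1 -
          (k ^ 2 * τ ^ ((3 : ℝ) / 2) *
          (∫ x in D ∩ ball x₀ δ, Real.exp (-2 * s * dist x x₀))) * mul_inv_cancel₀ hτ0.ne'
    _ ≤ _ := by gcongr
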